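/- arXiv:math/0307167 — 2 statements merged into one kernel-verified Lean document; each statement's English description precedes it below -/
import Mathlib

section
/- Consider the (non-parameterized) discrete-time cascade x(k+1)=f(k,x(k),y(k)), y(k+1)=g(k,y(k)), and suppose there exist γ₂ continuous nondecreasing and γ₁,γ₃ of class K∞ such that for all x,y and all k≥0: |f(k,x,y)| ≤ γ₁(|(x,y)|) and |f(k,x,y)−f(k,x,0)| ≤ γ₂(|x|)·γ₃(|y|). Then the cascade is UGAS if: (1) the system x(k+1)=f(k,x(k),0) is Lyapunov UGAS; (2) the system y(k+1)=g(k,y(k)) is UGAS; and (3) the cascade is UGB. -/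
open Filter Topology

/-- Class `K` functions: continuous on `[0,∞)`, strictly increasing there, and zero at zero. -/
def ClassK (α : ℝ → ℝ) : Prop :=
  ContinuousOn α (Set.Ici 0) ∧ StrictMonoOn α (Set.Ici 0) ∧ α 0 = 0

/-- Class `K∞` functions: class `K` and unbounded. -/
def ClassKInfty (α : ℝ → ℝ) : Prop :=
  ClassK α ∧ ∀ M : ℝ, ∃ s : ℝ, 0 ≤ s ∧ M < α s

/-- Class `KL` functions. -/
def ClassKL (β : ℝ → ℝ → ℝ) : Prop :=
  (∀ t : ℝ, 0 < t → ClassK (fun s => β s t)) ∧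
  (∀ s : ℝ, 0 < s → AntitoneOn (fun t => β s t) (Set.Ici 0) ∧
    Filter.Tendsto (fun t => β s t) Filter.atTop (nhds 0))

/-- Class `N` functions: continuous, nondecreasing and nonnegative on `[0,∞)`. -/
def ClassN (γ : ℝ → ℝ) : Prop :=
  ContinuousOn γ (Set.Ici 0) ∧ MonotoneOn γ (Set.Ici 0) ∧ ∀ s : ℝ, 0 ≤ s → 0 ≤ γ s

/-- Euclidean norm of the joint state `(x, z)`. -/
noncomputable def jnorm {E F : Type*} [NormedAddCommGroup E] [NormedAddCommGroup F]
    (x : E) (z : F) : ℝ :=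
  Real.sqrt (‖x‖ ^ 2 + ‖z‖ ^ 2)

/-- UGAS of a (non-parameterized) discrete-time system `w(k+1) = F(k, w(k))`. -/
def UGAS {G : Type*} [NormedAddCommGroup G] (F : ℕ → G → G) : Prop :=
  ∃ β : ℝ → ℝ → ℝ, ClassKL β ∧
    ∀ k₀ : ℕ, ∀ w : ℕ → G, (∀ k, k₀ ≤ k → w (k + 1) = F k (w k)) →
      ∀ k, k₀ ≤ k → ‖w k‖ ≤ β ‖w k₀‖ ((k - k₀ : ℕ) : ℝ)

/-- Lyapunov UGAS of a (non-parameterized) discrete-time system `w(k+1) = F(k, w(k))`. -/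
def LyapUGAS {G : Type*} [NormedAddCommGroup G] (F : ℕ → G → G) : Prop :=
  ∃ α₁ α₂ α₃ L : ℝ → ℝ, ∃ V : ℕ → G → ℝ,
    ClassKInfty α₁ ∧ ClassKInfty α₂ ∧ ClassK α₃ ∧ ClassN L ∧
    (∀ k, Continuous (V k)) ∧ (∀ k w, 0 ≤ V k w) ∧
    (∀ k : ℕ, ∀ w : G,
      α₁ ‖w‖ ≤ V k w ∧ V k w ≤ α₂ ‖w‖ ∧ V (k + 1) (F k w) - V k w ≤ -α₃ ‖w‖) ∧
    (∀ k : ℕ, ∀ r s : G, |V k r - V k s| ≤ L (max ‖r‖ ‖s‖) * ‖r - s‖)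

/-- UGAS of the cascade `x(k+1)=f(k,x,y)`, `y(k+1)=g(k,y)`. -/
def CascadeUGAS {E F : Type*} [NormedAddCommGroup E] [NormedAddCommGroup F]
    (f : ℕ → E → F → E) (g : ℕ → F → F) : Prop :=
  ∃ β : ℝ → ℝ → ℝ, ClassKL β ∧
    ∀ k₀ : ℕ, ∀ x : ℕ → E, ∀ y : ℕ → F,
      (∀ k, k₀ ≤ k → x (k + 1) = f k (x k) (y k)) →
      (∀ k, k₀ ≤ k → y (k + 1) = g k (y k)) →
      ∀ k, k₀ ≤ k → jnorm (x k) (y k) ≤ β (jnorm (x k₀) (y k₀)) ((k - k₀ : ℕ) : ℝ)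

/-- UGB of the cascade `x(k+1)=f(k,x,y)`, `y(k+1)=g(k,y)`. -/
def CascadeUGB {E F : Type*} [NormedAddCommGroup E] [NormedAddCommGroup F]
    (f : ℕ → E → F → E) (g : ℕ → F → F) : Prop :=
  ∃ κ : ℝ → ℝ, ∃ c : ℝ, ClassKInfty κ ∧ 0 ≤ c ∧
    ∀ k₀ : ℕ, ∀ x : ℕ → E, ∀ y : ℕ → F,
      (∀ k, k₀ ≤ k → x (k + 1) = f k (x k) (y k)) →
      (∀ k, k₀ ≤ k → y (k + 1) = g k (y k)) →
      ∀ k, k₀ ≤ k → jnorm (x k) (y k) ≤ κ (jnorm (x k₀) (y k₀)) + c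

namespace ClassK

variable {α : ℝ → ℝ}

theorem monotoneOn (h : ClassK α) : MonotoneOn α (Set.Ici 0) := h.2.1.monotoneOn

theorem nonneg (h : ClassK α) {s : ℝ} (hs : 0 ≤ s) : 0 ≤ α s := by
  simpa [h.2.2] using h.monotoneOn Set.self_mem_Ici hs hs

theorem pos (h : ClassK α) {s : ℝ} (hs : 0 < s) : 0 < α s := by
  simpa [h.2.2] using h.2.1 Set.self_mem_Ici hs.le hs

theorem le_of_le (h : ClassK α) {s t : ℝ} (hs : 0 ≤ s) (ht : 0 ≤ t) (hst : α s ≤ α t) : s ≤ t :=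
  (h.2.1.le_iff_le hs ht).1 hst

theorem exists_forall_le (h : ClassK α) {ε : ℝ} (hε : 0 < ε) :
    ∃ δ > 0, ∀ s, 0 ≤ s → s ≤ δ → α s ≤ ε := by
  obtain ⟨δ, hδ, H⟩ := Metric.continuousWithinAt_iff.1 (h.1 0 Set.self_mem_Ici) ε hε
  refine ⟨δ / 2, half_pos hδ, fun s hs hsδ => ?_⟩
  have hd := H (x := s) hs (by rw [Real.dist_eq, sub_zero, abs_of_nonneg hs]; linarith)
  rw [Real.dist_eq, h.2.2, sub_zero] at hd
  exact (le_abs_self _).trans hd.le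

end ClassK

/-- A family of responses that is bounded on bounded sets of initial data,
uniformly stable and uniformly attractive is dominated by a class `KL` function. Here `S s n v`
means that the value `v` is attained after `n` steps from an initial value `s`. -/
theorem exists_classKL_of_stable_of_attractive (S : ℝ → ℕ → ℝ → Prop)
    (hbdd : ∀ r, ∃ B, ∀ s ≤ r, ∀ n v, S s n v → v ≤ B)
    (hstab : ∀ ε > 0, ∃ δ > 0, ∀ s ≤ δ, ∀ n v, S s n v → v ≤ ε)
    (hattr : ∀ r, ∀ ε > 0, ∃ T : ℕ, ∀ s ≤ r, ∀ n ≥ T, ∀ v, S s n v → v ≤ ε) :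
    ∃ β, ClassKL β ∧ ∀ s, 0 ≤ s → ∀ n v, S s n v → v ≤ β s (n : ℝ) := by
  set A : ℝ → ℝ → Set ℝ :=
    fun r t => insert 0 {v | ∃ s ≤ r, ∃ n : ℕ, t ≤ n ∧ S s n v}
  set φ : ℝ → ℝ → ℝ := fun r t => sSup (A r t)
  have bddA (r t) : BddAbove (A r t) := by
    obtain ⟨B, hB⟩ := hbdd r
    refine ⟨max 0 B, ?_⟩
    rintro v (rfl | ⟨s, hs, n, -, hv⟩)
    · exact le_max_left _ _
    · exact (hB s hs n v hv).trans (le_max_right _ _)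
  have φ_nonneg (r t) : 0 ≤ φ r t := le_csSup (bddA r t) (Set.mem_insert _ _)
  have φ_le {r t ε : ℝ} (hε : 0 ≤ ε) (h : ∀ s ≤ r, ∀ n : ℕ, t ≤ n → ∀ v, S s n v → v ≤ ε) :
      φ r t ≤ ε := by
    refine csSup_le ⟨0, Set.mem_insert _ _⟩ ?_
    rintro v (rfl | ⟨s, hs, n, hn, hv⟩)
    exacts [hε, h s hs n hn v hv]
  have le_φ {s : ℝ} {n : ℕ} {v : ℝ} (h : S s n v) : v ≤ φ s n :=
    le_csSup (bddA _ _) (Or.inr ⟨s, le_rfl, n, le_rfl, h⟩)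
  have φ_mono (t) : Monotone fun r => φ r t := by
    intro r r' hr
    refine csSup_le_csSup (bddA _ _) ⟨0, Set.mem_insert _ _⟩ (Set.insert_subset_insert ?_)
    rintro v ⟨s, hs, n, hn, hv⟩
    exact ⟨s, hs.trans hr, n, hn, hv⟩
  have φ_anti (r) : Antitone fun t => φ r t := by
    intro t t' ht
    refine csSup_le_csSup (bddA _ _) ⟨0, Set.mem_insert _ _⟩ (Set.insert_subset_insert ?_)
    rintro v ⟨s, hs, n, hn, hv⟩
    exact ⟨s, hs, n, ht.trans hn, hv⟩
  have φ_small : ∀ ε > 0, ∃ δ > 0, ∀ r ≤ δ, ∀ t, φ r t ≤ ε := by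
    intro ε hε
    obtain ⟨δ, hδ, H⟩ := hstab ε hε
    exact ⟨δ, hδ, fun r hr t => φ_le hε.le fun s hs n _ v hv => H s (hs.trans hr) n v hv⟩
  have φ_zero (t) : φ 0 t = 0 := by
    refine le_antisymm (le_of_forall_pos_le_add fun ε hε => ?_) (φ_nonneg _ _)
    obtain ⟨δ, hδ, H⟩ := φ_small ε hε
    simpa using H 0 hδ.le t
  have φ_tendsto (r) : Tendsto (fun t => φ r t) atTop (𝓝 0) := by
    rw [Metric.tendsto_atTop]
    intro ε hε
    obtain ⟨T, hT⟩ := hattr r (ε / 2) (half_pos hε)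
    refine ⟨T, fun t ht => ?_⟩
    rw [Real.dist_eq, sub_zero, abs_of_nonneg (φ_nonneg _ _)]
    refine (φ_le (half_pos hε).le fun s hs n hn v hv => hT s hs n ?_ v hv).trans_lt (half_lt_self hε)
    exact_mod_cast ht.le.trans hn
  set ψ : ℝ → ℝ → ℝ := fun s t => ∫ u in (1 : ℝ)..2, φ (s * u) t with hψ
  have int_φ (t a b) : IntervalIntegrable (fun r => φ r t) MeasureTheory.volume a b :=
    (φ_mono t).intervalIntegrable
  have int_ψ {s : ℝ} (hs : 0 ≤ s) (t) :
      IntervalIntegrable (fun u => φ (s * u) t) MeasureTheory.volume 1 2 := by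
    refine Monotone.intervalIntegrable fun u u' hu => ?_
    exact φ_mono t (mul_le_mul_of_nonneg_left hu hs)
  have ψ_mono (t) {s s' : ℝ} (hs : 0 ≤ s) (h : s ≤ s') : ψ s t ≤ ψ s' t := by
    refine intervalIntegral.integral_mono_on one_le_two (int_ψ hs t) (int_ψ (hs.trans h) t) ?_
    intro u hu
    exact φ_mono t (mul_le_mul_of_nonneg_right h (by linarith [hu.1]))
  have ψ_anti {s : ℝ} (hs : 0 ≤ s) {t t' : ℝ} (h : t ≤ t') : ψ s t' ≤ ψ s t :=
    intervalIntegral.integral_mono_on one_le_two (int_ψ hs _) (int_ψ hs _) fun u _ => φ_anti _ h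
  have ψ_le {s : ℝ} (hs : 0 ≤ s) (t) : ψ s t ≤ φ (s * 2) t := by
    have := intervalIntegral.integral_mono_on (g := fun _ => φ (s * 2) t) one_le_two (int_ψ hs t)
      intervalIntegrable_const fun u hu => φ_mono t (mul_le_mul_of_nonneg_left hu.2 hs)
    simpa [show (2 : ℝ) - 1 = 1 by norm_num] using this
  have φ_le_ψ {s : ℝ} (hs : 0 ≤ s) (t) : φ s t ≤ ψ s t := by
    have := intervalIntegral.integral_mono_on (f := fun _ => φ s t) one_le_two
      intervalIntegrable_const (int_ψ hs t)
      fun u hu => φ_mono t (le_mul_of_one_le_right hs hu.1)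
    simpa [show (2 : ℝ) - 1 = 1 by norm_num] using this
  have ψ_nonneg {s : ℝ} (hs : 0 ≤ s) (t) : 0 ≤ ψ s t := (φ_nonneg s t).trans (φ_le_ψ hs t)
  have ψ_zero (t) : ψ 0 t = 0 := by simp [hψ, φ_zero]
  have ψ_cont (t) : ContinuousOn (fun s => ψ s t) (Set.Ici 0) := by
    intro s hs
    rcases (Set.mem_Ici.1 hs).eq_or_lt with rfl | hs
    · rw [Metric.continuousWithinAt_iff]
      intro ε hε
      obtain ⟨δ, hδ, H⟩ := φ_small (ε / 2) (half_pos hε)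
      refine ⟨δ / 2, half_pos hδ, fun {s} hs hsδ => ?_⟩
      rw [Real.dist_eq, sub_zero, abs_of_nonneg hs] at hsδ
      rw [Real.dist_eq, ψ_zero, sub_zero, abs_of_nonneg (ψ_nonneg hs t)]
      exact ((ψ_le hs t).trans (H _ (by linarith) t)).trans_lt (half_lt_self hε)
    · have hprim : Continuous fun b => ∫ r in (0 : ℝ)..b, φ r t :=
        intervalIntegral.continuous_primitive (int_φ t) 0
      have hc : ContinuousAt (fun s : ℝ =>
          s⁻¹ * ((∫ r in (0 : ℝ)..(s * 2), φ r t) - ∫ r in (0 : ℝ)..s, φ r t)) s :=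
        (continuousAt_inv₀ hs.ne').mul (by fun_prop)
      refine (hc.congr ?_).continuousWithinAt
      filter_upwards [eventually_ne_nhds hs.ne'] with s' hs'
      rw [intervalIntegral.integral_interval_sub_left (int_φ t _ _) (int_φ t _ _)]
      simp [hψ, intervalIntegral.integral_comp_mul_left (fun r => φ r t) hs']
  refine ⟨fun s t => ψ s t + s * Real.exp (-t), ⟨fun t _ => ⟨?_, ?_, ?_⟩, fun s hs => ⟨?_, ?_⟩⟩, ?_⟩
  · exact (ψ_cont t).add (by fun_prop)
  · intro s hs s' hs' h
    exact add_lt_add_of_le_of_lt (ψ_mono t hs h.le) (mul_lt_mul_of_pos_right h (Real.exp_pos _))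
  · simp [ψ_zero]
  · intro t _ t' _ h
    exact add_le_add (ψ_anti hs.le h)
      (mul_le_mul_of_nonneg_left (Real.exp_le_exp.2 (neg_le_neg h)) hs.le)
  · have h₁ : Tendsto (fun t => ψ s t) atTop (𝓝 0) :=
      squeeze_zero (fun t => ψ_nonneg hs.le t) (fun t => ψ_le hs.le t) (φ_tendsto _)
    simpa using h₁.add (Real.tendsto_exp_neg_atTop_nhds_zero.const_mul s)
  · intro s hs n v hv
    have := mul_nonneg hs (Real.exp_pos (-(n : ℝ))).le
    linarith [le_φ hv, φ_le_ψ hs n]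

section UGAS

variable {G : Type*} [NormedAddCommGroup G] {F : ℕ → G → G}

theorem UGAS.stable (h : UGAS F) {ε : ℝ} (hε : 0 < ε) :
    ∃ δ > 0, ∀ k₀ : ℕ, ∀ w : ℕ → G, (∀ k, k₀ ≤ k → w (k + 1) = F k (w k)) → ‖w k₀‖ ≤ δ →
      ∀ k, k₀ ≤ k → ‖w k‖ ≤ ε := by
  obtain ⟨β, ⟨hK, hL⟩, hβ⟩ := h
  obtain ⟨δ, hδ, H⟩ := (hK 1 one_pos).exists_forall_le hε
  refine ⟨min δ ε, lt_min hδ hε, fun k₀ w hw hw₀ k hk => ?_⟩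
  rcases hk.eq_or_lt with rfl | hlt
  · exact hw₀.trans (min_le_right _ _)
  have h₁ : (1 : ℝ) ≤ ((k - k₀ : ℕ) : ℝ) := by exact_mod_cast (by omega : 1 ≤ k - k₀)
  refine (hβ k₀ w hw k hk).trans ?_
  rcases (norm_nonneg (w k₀)).eq_or_lt with h₀ | h₀
  · rw [← h₀]
    exact (hK _ (one_pos.trans_le h₁)).2.2.trans_le hε.le
  · exact ((hL _ h₀).1 (Set.mem_Ici.2 zero_le_one) (Set.mem_Ici.2 (zero_le_one.trans h₁)) h₁).trans
      (H _ h₀.le (hw₀.trans (min_le_left _ _)))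

theorem UGAS.attractive (h : UGAS F) (r : ℝ) {ε : ℝ} (hε : 0 < ε) :
    ∃ T : ℕ, ∀ k₀ : ℕ, ∀ w : ℕ → G, (∀ k, k₀ ≤ k → w (k + 1) = F k (w k)) → ‖w k₀‖ ≤ r →
      ∀ k, k₀ + T ≤ k → ‖w k‖ ≤ ε := by
  obtain ⟨β, ⟨hK, hL⟩, hβ⟩ := h
  have hr : 0 < max r 1 := one_pos.trans_le (le_max_right _ _)
  obtain ⟨T, hT⟩ := eventually_atTop.1
    (((hL _ hr).2.comp tendsto_natCast_atTop_atTop).eventually (eventually_le_nhds hε))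
  refine ⟨T + 1, fun k₀ w hw hw₀ k hk => (hβ k₀ w hw k (by omega)).trans ?_⟩
  have hpos : (0 : ℝ) < ((k - k₀ : ℕ) : ℝ) := by exact_mod_cast (by omega : 0 < k - k₀)
  exact ((hK _ hpos).monotoneOn (norm_nonneg _) hr.le (hw₀.trans (le_max_left _ _))).trans
    (hT (k - k₀) (by omega))

end UGAS

/-- Practical decrease: a Lyapunov sequence with small enough perturbation `d` enters the
sublevel `c` at a uniform rate and never leaves it. -/
theorem exists_lyapunov_decrease {α₂ α₃ : ℝ → ℝ} (h₂ : ClassK α₂) (h₃ : ClassK α₃) {c : ℝ}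
    (hc : 0 < c) :
    ∃ a > 0, ∃ d > 0, ∀ (v z : ℕ → ℝ) (k₁ : ℕ),
      (∀ k, k₁ ≤ k → 0 ≤ z k ∧ v k ≤ α₂ (z k) ∧ v (k + 1) ≤ v k - α₃ (z k) + d) →
      ∀ n : ℕ, v (k₁ + n) ≤ max c (v k₁ - n * a) := by
  obtain ⟨σ, hσ, H⟩ := h₂.exists_forall_le (half_pos hc)
  have hpos := h₃.pos hσ
  refine ⟨α₃ σ / 2, half_pos hpos, min (c / 2) (α₃ σ / 2),
    lt_min (half_pos hc) (half_pos hpos), fun v z k₁ hv n => ?_⟩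
  induction n with
  | zero => simp
  | succ n ih =>
    obtain ⟨hz, hle, hstep⟩ := hv (k₁ + n) (by omega)
    have hd₁ := min_le_left (c / 2) (α₃ σ / 2)
    have hd₂ := min_le_right (c / 2) (α₃ σ / 2)
    rw [← add_assoc]
    push_cast
    rcases le_total (z (k₁ + n)) σ with h | h
    · have := H _ hz h
      have := h₃.nonneg hz
      exact le_max_of_le_left (by linarith)
    · have := h₃.monotoneOn hσ.le hz h
      rcases le_max_iff.1 ih with h' | h'
      · exact le_max_of_le_left (by linarith)
      · exact le_max_of_le_right (by linarith)

section Cascade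

variable {E F : Type*} [NormedAddCommGroup E] [NormedAddCommGroup F]

theorem jnorm_nonneg (x : E) (y : F) : 0 ≤ jnorm x y := Real.sqrt_nonneg _

theorem norm_fst_le_jnorm (x : E) (y : F) : ‖x‖ ≤ jnorm x y :=
  Real.le_sqrt_of_sq_le (by nlinarith [sq_nonneg ‖y‖])

theorem norm_snd_le_jnorm (x : E) (y : F) : ‖y‖ ≤ jnorm x y :=
  Real.le_sqrt_of_sq_le (by nlinarith [sq_nonneg ‖x‖])

theorem jnorm_le_add (x : E) (y : F) : jnorm x y ≤ ‖x‖ + ‖y‖ :=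
  Real.sqrt_le_iff.2 ⟨by positivity, by nlinarith [norm_nonneg x, norm_nonneg y]⟩

theorem jnorm_zero_right (x : E) : jnorm x (0 : F) = ‖x‖ := by simp [jnorm]

/-- Along trajectories of the cascade bounded by `R`, the state `x` is ultimately small as soon as
the input `y` is small, at a rate depending only on `R`; it stays small if it starts small. -/
theorem LyapUGAS.exists_input_bound {f : ℕ → E → F → E} {γ₁ γ₂ γ₃ : ℝ → ℝ}
    (hγ₁ : ClassK γ₁) (hγ₂ : ClassN γ₂) (hγ₃ : ClassK γ₃)
    (hbound : ∀ k : ℕ, ∀ x y, ‖f k x y‖ ≤ γ₁ (jnorm x y) ∧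
      ‖f k x y - f k x 0‖ ≤ γ₂ ‖x‖ * γ₃ ‖y‖)
    (h : LyapUGAS (fun k x => f k x 0)) {R : ℝ} (hR : 0 ≤ R) {ε : ℝ} (hε : 0 < ε) :
    ∃ δ > 0, ∃ η > 0, ∃ T : ℕ, ∀ (k₁ : ℕ) (x : ℕ → E) (y : ℕ → F),
      (∀ k, k₁ ≤ k → x (k + 1) = f k (x k) (y k) ∧ jnorm (x k) (y k) ≤ R ∧ ‖y k‖ ≤ δ) →
      (∀ k, k₁ + T ≤ k → ‖x k‖ ≤ ε) ∧ (‖x k₁‖ ≤ η → ∀ k, k₁ ≤ k → ‖x k‖ ≤ ε) := by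
  obtain ⟨α₁, α₂, α₃, L, V, ⟨hα₁, -⟩, ⟨hα₂, -⟩, hα₃, hL, -, -, hV, hVL⟩ := h
  have hc := hα₁.pos hε
  obtain ⟨a, ha, d, hd, hdec⟩ := exists_lyapunov_decrease hα₂ hα₃ hc
  have hγR := hγ₁.nonneg hR
  have hM : 0 ≤ L (γ₁ R) * γ₂ R := mul_nonneg (hL.2.2 _ hγR) (hγ₂.2.2 _ hR)
  obtain ⟨δ, hδ, hδd⟩ := hγ₃.exists_forall_le (ε := d / (L (γ₁ R) * γ₂ R + 1)) (by positivity)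
  obtain ⟨η, hη, hηc⟩ := hα₂.exists_forall_le hc
  obtain ⟨T, hT⟩ := exists_nat_ge (α₂ R / a)
  rw [div_le_iff₀ ha] at hT
  refine ⟨δ, hδ, η, hη, T, fun k₁ x y hxy => ?_⟩
  have hxR (k) (hk : k₁ ≤ k) : ‖x k‖ ≤ R := (norm_fst_le_jnorm _ _).trans (hxy k hk).2.1
  have hpert (k) (hk : k₁ ≤ k) :
      |V (k + 1) (f k (x k) (y k)) - V (k + 1) (f k (x k) 0)| ≤ d := by
    obtain ⟨-, hj, hy⟩ := hxy k hk
    have hf₁ : ‖f k (x k) (y k)‖ ≤ γ₁ R :=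
      (hbound k _ _).1.trans (hγ₁.monotoneOn (jnorm_nonneg _ _) hR hj)
    have hf₂ : ‖f k (x k) 0‖ ≤ γ₁ R := by
      refine (hbound k _ _).1.trans (hγ₁.monotoneOn (jnorm_nonneg _ _) hR ?_)
      rw [jnorm_zero_right]
      exact hxR k hk
    have hmax := max_le hf₁ hf₂
    have hL' := hL.2.1 (le_max_of_le_left (norm_nonneg _)) hγR hmax
    have hγ₃δ := hδd _ (norm_nonneg _) hy
    rw [le_div_iff₀ (by positivity)] at hγ₃δ
    have hγ₃0 := hγ₃.nonneg (norm_nonneg (y k))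
    calc
      _ ≤ _ := hVL _ _ _
      _ ≤ L (γ₁ R) * (γ₂ ‖x k‖ * γ₃ ‖y k‖) :=
        mul_le_mul hL' (hbound k _ _).2 (norm_nonneg _) (hL.2.2 _ hγR)
      _ ≤ L (γ₁ R) * (γ₂ R * γ₃ ‖y k‖) := by
        have := hγ₂.2.1 (norm_nonneg (x k)) hR (hxR k hk)
        have := hL.2.2 _ hγR
        gcongr
      _ ≤ d := by linarith
  have hdec' := hdec (fun k => V k (x k)) (fun k => ‖x k‖) k₁ fun k hk => by
    have h₁ := (abs_le.1 (hpert k hk)).2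
    have h₂ := (hV k (x k)).2.2
    refine ⟨norm_nonneg _, (hV k _).2.1, ?_⟩
    simp only [(hxy k hk).1]
    linarith
  have hsmall (n : ℕ) (hn : V k₁ (x k₁) - n * a ≤ α₁ ε) : ‖x (k₁ + n)‖ ≤ ε :=
    hα₁.le_of_le (norm_nonneg _) hε.le <|
      (hV _ _).1.trans ((hdec' n).trans (max_le le_rfl hn))
  constructor
  · intro k hk
    obtain ⟨n, rfl⟩ := Nat.exists_eq_add_of_le (show k₁ ≤ k by omega)
    refine hsmall n ?_
    have h₁ : (T : ℝ) ≤ n := by exact_mod_cast (by omega : T ≤ n)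
    have h₂ := (hV k₁ (x k₁)).2.1.trans (hα₂.monotoneOn (norm_nonneg _) hR (hxR k₁ le_rfl))
    have h₃ := mul_le_mul_of_nonneg_right h₁ ha.le
    linarith
  · intro hx k hk
    obtain ⟨n, rfl⟩ := Nat.exists_eq_add_of_le hk
    refine hsmall n ?_
    have h₁ := (hV k₁ (x k₁)).2.1.trans (hηc _ (norm_nonneg _) hx)
    have h₂ : 0 ≤ n * a := by positivity
    linarith

end Cascade

/-- Corollary 2: under the growth/interconnection bounds on `f`, Lyapunov UGAS
of the zero-input subsystem, UGAS of the `y`-subsystem and UGB of the cascade imply UGAS of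
the cascade. -/
theorem stmt4 (nx ny : ℕ)
    (f : ℕ → EuclideanSpace ℝ (Fin nx) → EuclideanSpace ℝ (Fin ny) →
      EuclideanSpace ℝ (Fin nx))
    (g : ℕ → EuclideanSpace ℝ (Fin ny) → EuclideanSpace ℝ (Fin ny))
    (γ₁ γ₂ γ₃ : ℝ → ℝ)
    (hγ₁ : ClassKInfty γ₁) (hγ₂ : ClassN γ₂) (hγ₃ : ClassKInfty γ₃)
    (hbound : ∀ k : ℕ, ∀ x y, ‖f k x y‖ ≤ γ₁ (jnorm x y) ∧
      ‖f k x y - f k x 0‖ ≤ γ₂ ‖x‖ * γ₃ ‖y‖)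
    (h1 : LyapUGAS (fun k x => f k x 0))
    (h2 : UGAS g)
    (h3 : CascadeUGB f g) :
    CascadeUGAS f g := by
  obtain ⟨κ, c, ⟨hκ, -⟩, hc, hUGB⟩ := h3
  have hR (r : ℝ) : 0 ≤ κ (max r 0) + c := add_nonneg (hκ.nonneg (le_max_right _ _)) hc
  have hbd {r : ℝ} {k₀ : ℕ} {x : ℕ → EuclideanSpace ℝ (Fin nx)}
      {y : ℕ → EuclideanSpace ℝ (Fin ny)} (hx : ∀ k, k₀ ≤ k → x (k + 1) = f k (x k) (y k))
      (hy : ∀ k, k₀ ≤ k → y (k + 1) = g k (y k)) (hr : jnorm (x k₀) (y k₀) ≤ r)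
      (k : ℕ) (hk : k₀ ≤ k) : jnorm (x k) (y k) ≤ κ (max r 0) + c := by
    have := hκ.monotoneOn (jnorm_nonneg _ _) (le_max_right r 0) (hr.trans (le_max_left _ _))
    linarith [hUGB k₀ x y hx hy k hk]
  have hKL := exists_classKL_of_stable_of_attractive
    (fun s n v => ∃ (k₀ : ℕ) (x : ℕ → EuclideanSpace ℝ (Fin nx))
      (y : ℕ → EuclideanSpace ℝ (Fin ny)), (∀ k, k₀ ≤ k → x (k + 1) = f k (x k) (y k)) ∧
      (∀ k, k₀ ≤ k → y (k + 1) = g k (y k)) ∧ jnorm (x k₀) (y k₀) = s ∧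
      jnorm (x (k₀ + n)) (y (k₀ + n)) = v)
  refine (hKL ?_ ?_ ?_).imp fun β hβ => ⟨hβ.1, fun k₀ x y hx hy k hk =>
    hβ.2 _ (jnorm_nonneg _ _) _ _ ⟨k₀, x, y, hx, hy, rfl, by rw [Nat.add_sub_cancel' hk]⟩⟩
  · intro r
    refine ⟨κ (max r 0) + c, ?_⟩
    rintro _ hs n _ ⟨k₀, x, y, hx, hy, rfl, rfl⟩
    exact hbd hx hy hs _ (by omega)
  · intro ε hε
    obtain ⟨δ, hδ, η, hη, _, h⟩ :=
      h1.exists_input_bound hγ₁.1 hγ₂ hγ₃.1 hbound (hR 1) (half_pos hε)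
    obtain ⟨δ', hδ', hδy⟩ := h2.stable (lt_min hδ (half_pos hε))
    refine ⟨min 1 (min η δ'), by positivity, ?_⟩
    rintro _ hs n _ ⟨k₀, x, y, hx, hy, rfl, rfl⟩
    obtain ⟨hs₁, hs₂, hs₃⟩ : _ ∧ _ ∧ _ := by simpa only [le_min_iff] using hs
    have hyk := hδy k₀ y hy ((norm_snd_le_jnorm _ _).trans hs₃)
    have hxk := (h k₀ x y fun k hk =>
      ⟨hx k hk, hbd hx hy hs₁ k hk, (hyk k hk).trans (min_le_left _ _)⟩).2
      ((norm_fst_le_jnorm _ _).trans hs₂) (k₀ + n) (by omega)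
    have := (hyk (k₀ + n) (by omega)).trans (min_le_right _ _)
    linarith [jnorm_le_add (x (k₀ + n)) (y (k₀ + n))]
  · intro r ε hε
    obtain ⟨δ, hδ, _, -, T, h⟩ :=
      h1.exists_input_bound hγ₁.1 hγ₂ hγ₃.1 hbound (hR r) (half_pos hε)
    obtain ⟨T', hT'⟩ := h2.attractive r (lt_min hδ (half_pos hε))
    refine ⟨T' + T, ?_⟩
    rintro _ hs n hn _ ⟨k₀, x, y, hx, hy, rfl, rfl⟩
    have hyk := hT' k₀ y hy ((norm_snd_le_jnorm _ _).trans hs)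
    have hxk := (h (k₀ + T') x y fun k hk =>
      ⟨hx k (by omega), hbd hx hy hs k (by omega), (hyk k hk).trans (min_le_left _ _)⟩).1
      (k₀ + n) (by omega)
    have := (hyk (k₀ + n) (by omega)).trans (min_le_right _ _)
    linarith [jnorm_le_add (x (k₀ + n)) (y (k₀ + n))]
end

section
/- Consider the parameterized x-subsystem x(k+1)=f_T(k,x(k),z(k)) with input z. Suppose the solutions of the x-subsystem with input z are USC and the zero-input subsystem x(k+1)=f_T(k,x(k),0) is SP-UAS with KL function β_x. Then there exist c_x,c_u>0 and γ of class K such that for any ν>0 there exists T*>0 such that for all k₀≥0, all |x₀|≤c_x, all input sequences with ‖ω^z‖<c_u and all T∈(0,T*): |φ^x_T(k,k₀,x₀,ω^z_{[k₀,k)})| ≤ max{β_x(|x₀|,(k−k₀)T), ν} + γ(‖ω^z_{[k₀,k)}‖) for all k≥k₀, where ‖ω^z_{[k₀,k)}‖ denotes the maximum of |z(j)| over k₀≤j<k. -/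
open Filter Topology

/-- SP-UAS of a parameterized discrete-time system `y(k+1) = F_T(k, y(k))`. -/
def SPUAS {G : Type*} [NormedAddCommGroup G] (F : ℝ → ℕ → G → G) : Prop :=
  ∃ β : ℝ → ℝ → ℝ, ClassKL β ∧
    ∀ Δ ν : ℝ, 0 < Δ → 0 < ν → ∃ Tstar : ℝ, 0 < Tstar ∧
      ∀ T : ℝ, 0 < T → T < Tstar →
        ∀ k₀ : ℕ, ∀ y : ℕ → G, (∀ k, k₀ ≤ k → y (k + 1) = F T k (y k)) → ‖y k₀‖ ≤ Δ →
          ∀ k, k₀ ≤ k → ‖y k‖ ≤ max (β ‖y k₀‖ (((k - k₀ : ℕ) : ℝ) * T)) ν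

/-- SP-UAS of the parameterized cascade `x(k+1)=f_T(k,x,z)`, `z(k+1)=g_T(k,z)`,
with the Euclidean norm of the joint state. -/
def CascadeSPUAS {E F : Type*} [NormedAddCommGroup E] [NormedAddCommGroup F]
    (f : ℝ → ℕ → E → F → E) (g : ℝ → ℕ → F → F) : Prop :=
  ∃ β : ℝ → ℝ → ℝ, ClassKL β ∧
    ∀ Δ ν : ℝ, 0 < Δ → 0 < ν → ∃ Tstar : ℝ, 0 < Tstar ∧
      ∀ T : ℝ, 0 < T → T < Tstar →
        ∀ k₀ : ℕ, ∀ x : ℕ → E, ∀ z : ℕ → F,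
          (∀ k, k₀ ≤ k → x (k + 1) = f T k (x k) (z k)) →
          (∀ k, k₀ ≤ k → z (k + 1) = g T k (z k)) →
          jnorm (x k₀) (z k₀) ≤ Δ →
          ∀ k, k₀ ≤ k →
            jnorm (x k) (z k) ≤ max (β (jnorm (x k₀) (z k₀)) (((k - k₀ : ℕ) : ℝ) * T)) ν

/-- Uniform semiglobal boundedness (USB) of the parameterized cascade. -/
def CascadeUSB {E F : Type*} [NormedAddCommGroup E] [NormedAddCommGroup F]
    (f : ℝ → ℕ → E → F → E) (g : ℝ → ℕ → F → F) : Prop :=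
  ∃ κ : ℝ → ℝ, ∃ c : ℝ, ClassKInfty κ ∧ 0 ≤ c ∧
    ∀ Δ : ℝ, 0 < Δ → ∃ Tstar : ℝ, 0 < Tstar ∧
      ∀ T : ℝ, 0 < T → T < Tstar →
        ∀ k₀ : ℕ, ∀ x : ℕ → E, ∀ z : ℕ → F,
          (∀ k, k₀ ≤ k → x (k + 1) = f T k (x k) (z k)) →
          (∀ k, k₀ ≤ k → z (k + 1) = g T k (z k)) →
          jnorm (x k₀) (z k₀) ≤ Δ →
          ∀ k, k₀ ≤ k → jnorm (x k) (z k) ≤ κ (jnorm (x k₀) (z k₀)) + c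

/-- Uniform semiglobal continuity (USC) of the solutions of `x(k+1)=f_T(k,x,z)`
with respect to the input `z`. -/
def USC {E F : Type*} [NormedAddCommGroup E] [NormedAddCommGroup F]
    (f : ℝ → ℕ → E → F → E) : Prop :=
  ∀ Δ : ℝ, 0 < Δ → ∃ Tstar : ℝ, 0 < Tstar ∧
    ∀ η ε L : ℝ, 0 < η → η < Δ → 0 < ε → 0 < L → ∃ μ : ℝ, 0 < μ ∧
      ∀ T : ℝ, 0 < T → T < Tstar →
        ∀ z : ℕ → F, (∀ k, ‖z k‖ ≤ μ) →
          ∀ k₀ : ℕ, ∀ xz x0 : ℕ → E,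
            (∀ k, k₀ ≤ k → xz (k + 1) = f T k (xz k) (z k)) →
            (∀ k, k₀ ≤ k → x0 (k + 1) = f T k (x0 k) 0) →
            xz k₀ = x0 k₀ → ‖xz k₀‖ ≤ η →
            ∀ k, k₀ ≤ k → k ≤ k₀ + Nat.floor (L / T) → ‖xz k - x0 k‖ ≤ ε

/-- Sup of the norms of the input over the finite segment `[k₀, k)`. -/
noncomputable def segSup {F : Type*} [NormedAddCommGroup F] (z : ℕ → F) (k₀ k : ℕ) : ℝ :=
  (((Finset.Ico k₀ k).sup fun j => ‖z j‖₊ : NNReal) : ℝ)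

/-- A class-`K` function that is at least `2 * (1 / 2) ^ n` above the threshold `μ (n + 1)`. -/
lemma exists_classK_ge_of_threshold_lt (μ : ℕ → ℝ) (hμ : ∀ n, 0 < μ n) :
    ∃ γ : ℝ → ℝ, ClassK γ ∧ ∀ n s, μ (n + 1) < s → 2 * (1 / 2 : ℝ) ^ n ≤ γ s := by
  set u : ℕ → ℝ → ℝ := fun n s => 4 * (1 / 2 : ℝ) ^ n * min 1 (max 0 s / μ n) with hu
  have hnonneg : ∀ n s, 0 ≤ u n s := fun n s => by
    have : 0 ≤ min 1 (max 0 s / μ n) :=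
      le_min zero_le_one (div_nonneg (le_max_left _ _) (hμ n).le)
    positivity
  have hle : ∀ n s, u n s ≤ 4 * (1 / 2 : ℝ) ^ n := fun n s =>
    mul_le_of_le_one_right (by positivity) (min_le_left _ _)
  have hgeom : Summable fun n : ℕ => 4 * (1 / 2 : ℝ) ^ n := summable_geometric_two.mul_left 4
  have hsum : ∀ s, Summable fun n => u n s := fun s =>
    hgeom.of_nonneg_of_le (fun n => hnonneg n s) fun n => hle n s
  have hcont : Continuous fun s => ∑' n, u n s := by
    refine continuous_tsum (fun n => ?_) hgeom fun n s => ?_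
    · simp only [hu]
      fun_prop
    · rw [Real.norm_of_nonneg (hnonneg n s)]
      exact hle n s
  have hmono : ∀ n, Monotone (u n) := fun n s t hst =>
    mul_le_mul_of_nonneg_left
      (min_le_min le_rfl (div_le_div_of_nonneg_right (max_le_max le_rfl hst) (hμ n).le))
      (by positivity)
  refine ⟨fun s => s + ∑' n, u n s, ⟨(continuous_id.add hcont).continuousOn, ?_, ?_⟩, ?_⟩
  · intro s _ t _ hst
    exact add_lt_add_of_lt_of_le hst ((hsum s).tsum_le_tsum (fun n => hmono n hst.le) (hsum t))
  · simp [hu]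
  · intro n s hs
    have hs0 : 0 < s := (hμ _).trans hs
    have hterm : u (n + 1) s = 2 * (1 / 2 : ℝ) ^ n := by
      have h1 : 1 ≤ max 0 s / μ (n + 1) := by
        rw [max_eq_right hs0.le, one_le_div (hμ _)]
        exact hs.le
      simp only [hu, min_eq_left h1, pow_succ]
      ring
    have hsingle : u (n + 1) s ≤ ∑' n, u n s :=
      (hsum s).le_tsum (n + 1) fun j _ => hnonneg j s
    show _ ≤ s + ∑' n, u n s
    linarith

lemma exists_solution_from {G : Type*} (F : ℕ → G → G) (k₀ : ℕ) (a : G) :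
    ∃ y : ℕ → G, y k₀ = a ∧ ∀ k, k₀ ≤ k → y (k + 1) = F k (y k) := by
  refine ⟨fun k => Nat.rec a (fun i v => F (k₀ + i) v) (k - k₀), by simp, fun k hk => ?_⟩
  have h1 : k + 1 - k₀ = (k - k₀) + 1 := by omega
  have h2 : k₀ + (k - k₀) = k := by omega
  simp only [h1, h2]

lemma ClassKL.le_of_le {β : ℝ → ℝ → ℝ} (hβ : ClassKL β) {s r t₁ t₂ : ℝ} (hs : 0 ≤ s)
    (hsr : s ≤ r) (hr : 0 < r) (ht₁ : 0 ≤ t₁) (ht : t₁ ≤ t₂) (ht₂ : 0 < t₂) :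
    β s t₂ ≤ β r t₁ :=
  ((hβ.1 t₂ ht₂).2.1.monotoneOn hs hr.le hsr).trans ((hβ.2 r hr).1 ht₁ ht₂.le ht)

section

variable {E F : Type*} [NormedAddCommGroup E] [NormedAddCommGroup F]

/-- Inputs that are small on the whole time axis perturb the practical `KL` estimate only
slightly, for a range of sampling periods independent of the size of the perturbation. -/
lemma exists_uniform_small_input_bound {f : ℝ → ℕ → E → F → E} {β : ℝ → ℝ → ℝ}
    (husc : USC f) (hβ : ClassKL β)
    (hspuas : ∀ Δ ν : ℝ, 0 < Δ → 0 < ν → ∃ Tstar : ℝ, 0 < Tstar ∧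
      ∀ T : ℝ, 0 < T → T < Tstar →
        ∀ k₀ : ℕ, ∀ x : ℕ → E,
          (∀ k, k₀ ≤ k → x (k + 1) = f T k (x k) 0) → ‖x k₀‖ ≤ Δ →
          ∀ k, k₀ ≤ k → ‖x k‖ ≤ max (β ‖x k₀‖ (((k - k₀ : ℕ) : ℝ) * T)) ν) :
    ∃ τ : ℝ → ℝ, (∀ ν, 0 < ν → 0 < τ ν) ∧ ∀ ε : ℝ, 0 < ε → ε ≤ 1 → ∃ μ : ℝ, 0 < μ ∧
      ∀ ν, 0 < ν → ∀ T, 0 < T → T < τ ν → ∀ z : ℕ → F, (∀ k, ‖z k‖ ≤ μ) →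
        ∀ k₀ : ℕ, ∀ x : ℕ → E, (∀ k, k₀ ≤ k → x (k + 1) = f T k (x k) (z k)) →
          ‖x k₀‖ ≤ 1 → ∀ k, k₀ ≤ k →
            ‖x k‖ ≤ max (β ‖x k₀‖ (((k - k₀ : ℕ) : ℝ) * T)) ν + 2 * ε := by
  set η : ℝ := max (β 1 0) 1 + 1 with hη
  have hη2 : 2 ≤ η := by linarith [le_max_right (β 1 0) 1]
  have hη0 : 0 < η := by linarith
  obtain ⟨T₁, hT₁, hcont⟩ := husc (η + 1) (by linarith)
  have hmin : ∀ ν : ℝ, 0 < ν → 0 < min ν 1 := fun ν hν => lt_min hν one_pos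
  choose! T₂ hT₂ hstab using fun ν (hν : 0 < ν) => hspuas η (min ν 1) hη0 (hmin ν hν)
  refine ⟨fun ν => min (min T₁ (T₂ ν)) 1,
    fun ν hν => lt_min (lt_min hT₁ (hT₂ ν hν)) one_pos, fun ε hε hε1 => ?_⟩
  obtain ⟨T₀, hT₀, hβT₀⟩ : ∃ T₀ : ℝ, 0 < T₀ ∧ β η T₀ < ε :=
    ((eventually_gt_atTop 0).and (((hβ.2 η hη0).2).eventually_lt_const hε)).exists
  obtain ⟨μ, hμ, hclose⟩ := hcont η ε (T₀ + 1) hη0 (by linarith) hε (by linarith)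
  refine ⟨μ, hμ, fun ν hν T hT hTτ z hz k₀ x hx hx₀ => ?_⟩
  obtain ⟨⟨hTT₁, hTT₂⟩, hT1⟩ : (T < T₁ ∧ T < T₂ ν) ∧ T < 1 := by simpa [lt_min_iff] using hTτ
  have window : ∀ j, k₀ ≤ j → ‖x j‖ ≤ η → ∀ k, j ≤ k → k ≤ j + ⌊(T₀ + 1) / T⌋₊ →
      ‖x k‖ ≤ max (β ‖x j‖ (((k - j : ℕ) : ℝ) * T)) (min ν 1) + ε := by
    intro j hj hxj k hjk hkj
    obtain ⟨y, hyj, hy⟩ := exists_solution_from (fun k v => f T k v 0) j (x j)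
    have h1 := hclose T hT hTT₁ z hz j x y (fun i hi => hx i (hj.trans hi)) hy hyj.symm hxj
      k hjk hkj
    have h2 := hstab ν hν T hT hTT₂ j y hy (hyj ▸ hxj) k hjk
    rw [hyj] at h2
    linarith [norm_le_norm_add_norm_sub' (x k) (y k)]
  set N : ℕ := ⌈T₀ / T⌉₊ with hN
  have hN0 : 0 < N := Nat.ceil_pos.2 (by positivity)
  have hNT : T₀ ≤ N * T := (div_le_iff₀ hT).1 (Nat.le_ceil _)
  have hNfloor : N ≤ ⌊(T₀ + 1) / T⌋₊ := by
    refine Nat.le_floor ((Nat.ceil_lt_add_one (by positivity)).le.trans ?_)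
    rw [add_div]
    gcongr
    exact (one_le_div hT).2 hT1.le
  have late : ∀ k, k₀ + N < k → ‖x (k - N)‖ ≤ η → ‖x k‖ ≤ max ε (min ν 1) + ε := by
    intro k hk hxk
    refine (window (k - N) (by omega) hxk k (by omega) (by omega)).trans ?_
    have hkN : k - (k - N) = N := by omega
    rw [hkN]
    gcongr
    exact (hβ.le_of_le (norm_nonneg _) hxk hη0 hT₀.le hNT (hT₀.trans_le hNT)).trans hβT₀.le
  have hbdd : ∀ k, k₀ ≤ k → ‖x k‖ ≤ η := by
    intro k
    induction k using Nat.strong_induction_on with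
    | _ k ih =>
      intro hk
      rcases hk.eq_or_lt with rfl | hlt
      · linarith
      rcases le_or_gt k (k₀ + N) with hkN | hkN
      · refine (window k₀ le_rfl (by linarith) k hk (by omega)).trans ?_
        have ht : 0 < ((k - k₀ : ℕ) : ℝ) * T :=
          mul_pos (Nat.cast_pos.2 (by omega)) hT
        exact add_le_add (max_le_max
          (hβ.le_of_le (norm_nonneg _) hx₀ one_pos le_rfl ht.le ht) (min_le_right _ _)) hε1
      · have := late k hkN (ih (k - N) (by omega) (by omega))
        linarith [max_le hε1 (min_le_right ν 1)]
  intro k hk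
  rcases le_or_gt k (k₀ + N) with hkN | hkN
  · have h1 := window k₀ le_rfl (by linarith) k hk (by omega)
    linarith [max_le_max (le_refl (β ‖x k₀‖ (((k - k₀ : ℕ) : ℝ) * T))) (min_le_left ν 1)]
  · have h1 := late k hkN (hbdd _ (by omega))
    have h2 : max ε (min ν 1) ≤ ν + ε :=
      max_le (by linarith) ((min_le_left _ _).trans (by linarith))
    linarith [le_max_right (β ‖x k₀‖ (((k - k₀ : ℕ) : ℝ) * T)) ν]

lemma norm_le_segSup (z : ℕ → F) {k₀ k j : ℕ} (hj : k₀ ≤ j) (hjk : j < k) :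
    ‖z j‖ ≤ segSup z k₀ k :=
  NNReal.coe_le_coe.2
    (Finset.le_sup (f := fun j => ‖z j‖₊) (Finset.mem_Ico.2 ⟨hj, hjk⟩))

lemma segSup_nonneg (z : ℕ → F) (k₀ k : ℕ) : 0 ≤ segSup z k₀ k := NNReal.coe_nonneg _

lemma segSup_le {z : ℕ → F} {m : ℝ} (hm : 0 ≤ m) (hz : ∀ k, ‖z k‖ ≤ m) (k₀ k : ℕ) :
    segSup z k₀ k ≤ m := by
  lift m to NNReal using hm
  exact NNReal.coe_le_coe.2 (Finset.sup_le fun j _ => NNReal.coe_le_coe.1 (hz j))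

/-- The state at time `k` is also reached under the input truncated to `[k₀, k)`. -/
lemma exists_truncated_solution {G : Type*} (g : ℕ → G → F → G) (z : ℕ → F) (k₀ : ℕ)
    (x : ℕ → G)
    (hx : ∀ k, k₀ ≤ k → x (k + 1) = g k (x k) (z k)) (k : ℕ) :
    ∃ (w : ℕ → F) (y : ℕ → G), (∀ j, ‖w j‖ ≤ segSup z k₀ k) ∧
      (∀ j, k₀ ≤ j → y (j + 1) = g j (y j) (w j)) ∧ ∀ j, k₀ ≤ j → j ≤ k → y j = x j := by
  classical
  set w : ℕ → F := fun j => if k₀ ≤ j ∧ j < k then z j else 0 with hw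
  obtain ⟨y, hy₀, hy⟩ := exists_solution_from (fun j v => g j v (w j)) k₀ (x k₀)
  refine ⟨w, y, fun j => ?_, hy, fun j hj => ?_⟩
  · by_cases h : k₀ ≤ j ∧ j < k
    · simpa [hw, h] using norm_le_segSup z h.1 h.2
    · simpa [hw, h] using segSup_nonneg z k₀ k
  · induction j, hj using Nat.le_induction with
    | base => exact fun _ => hy₀
    | succ j hj ih =>
      intro hjk
      have hwj : w j = z j := if_pos ⟨hj, hjk⟩
      rw [hy j hj, hx j hj, ih (by omega), hwj]

end

/-- Lemma 3: under USC and SP-UAS of the zero-input subsystem with `KL` bound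
`β_x`, there are `c_x, c_u > 0` and a class-`K` gain `γ` giving a semiglobal practical ISS-type
estimate with gain on the input segment. -/
theorem stmt9 (nx nz : ℕ)
    (f : ℝ → ℕ → EuclideanSpace ℝ (Fin nx) → EuclideanSpace ℝ (Fin nz) →
      EuclideanSpace ℝ (Fin nx))
    (βx : ℝ → ℝ → ℝ) (husc : USC f) (hβx : ClassKL βx)
    (hspuas : ∀ Δ ν : ℝ, 0 < Δ → 0 < ν → ∃ Tstar : ℝ, 0 < Tstar ∧
      ∀ T : ℝ, 0 < T → T < Tstar →
        ∀ k₀ : ℕ, ∀ x : ℕ → EuclideanSpace ℝ (Fin nx),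
          (∀ k, k₀ ≤ k → x (k + 1) = f T k (x k) 0) → ‖x k₀‖ ≤ Δ →
          ∀ k, k₀ ≤ k → ‖x k‖ ≤ max (βx ‖x k₀‖ (((k - k₀ : ℕ) : ℝ) * T)) ν) :
    ∃ cx cu : ℝ, ∃ γ : ℝ → ℝ, 0 < cx ∧ 0 < cu ∧ ClassK γ ∧
      ∀ ν : ℝ, 0 < ν → ∃ Tstar : ℝ, 0 < Tstar ∧
        ∀ T : ℝ, 0 < T → T < Tstar →
          ∀ z : ℕ → EuclideanSpace ℝ (Fin nz), (∃ m : ℝ, m < cu ∧ ∀ k, ‖z k‖ ≤ m) →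
            ∀ k₀ : ℕ, ∀ x : ℕ → EuclideanSpace ℝ (Fin nx),
              (∀ k, k₀ ≤ k → x (k + 1) = f T k (x k) (z k)) → ‖x k₀‖ ≤ cx →
              ∀ k, k₀ ≤ k →
                ‖x k‖ ≤ max (βx ‖x k₀‖ (((k - k₀ : ℕ) : ℝ) * T)) ν + γ (segSup z k₀ k) := by
  obtain ⟨τ, hτ, hsmall⟩ := exists_uniform_small_input_bound husc hβx hspuas
  choose μ hμ hbound using fun n : ℕ =>
    hsmall ((1 / 2 : ℝ) ^ n) (by positivity) (pow_le_one₀ (by norm_num) (by norm_num))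
  obtain ⟨γ, hγ, hγμ⟩ := exists_classK_ge_of_threshold_lt μ hμ
  refine ⟨1, μ 0, γ, one_pos, hμ 0, hγ, fun ν hν => ⟨τ ν, hτ ν hν, ?_⟩⟩
  rintro T hT hTτ z ⟨m, hm, hz⟩ k₀ x hx hx₀ k hk
  obtain ⟨w, y, hw, hy, hyx⟩ := exists_truncated_solution (f T) z k₀ x hx k
  have hy₀ : y k₀ = x k₀ := hyx k₀ le_rfl hk
  have key : ∀ n, segSup z k₀ k ≤ μ n →
      ‖x k‖ ≤ max (βx ‖x k₀‖ (((k - k₀ : ℕ) : ℝ) * T)) ν + 2 * (1 / 2 : ℝ) ^ n := by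
    intro n hn
    have := hbound n ν hν T hT hTτ w (fun j => (hw j).trans hn) k₀ y hy (hy₀ ▸ hx₀) k hk
    rwa [hy₀, hyx k hk le_rfl] at this
  have h0 : segSup z k₀ k ≤ μ 0 := (segSup_le ((norm_nonneg _).trans (hz 0)) hz k₀ k).trans hm.le
  by_cases hall : ∀ n, segSup z k₀ k ≤ μ n
  · have hlim : Tendsto (fun n : ℕ => max (βx ‖x k₀‖ (((k - k₀ : ℕ) : ℝ) * T)) ν +
        2 * (1 / 2 : ℝ) ^ n) atTop (𝓝 (max (βx ‖x k₀‖ (((k - k₀ : ℕ) : ℝ) * T)) ν + 2 * 0)) :=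
      ((tendsto_pow_atTop_nhds_zero_of_lt_one (by norm_num) (by norm_num)).const_mul 2).const_add _
    have hle := ge_of_tendsto' hlim fun n => key n (hall n)
    have hγ0 : 0 ≤ γ (segSup z k₀ k) := by
      simpa [hγ.2.2] using hγ.2.1.monotoneOn (Set.self_mem_Ici) (segSup_nonneg z k₀ k)
        (segSup_nonneg z k₀ k)
    linarith
  · obtain ⟨n, hn, hn1⟩ : ∃ n, segSup z k₀ k ≤ μ n ∧ μ (n + 1) < segSup z k₀ k := by
      by_contra! hstep
      exact hall fun n => Nat.rec h0 (fun n ih => hstep n ih) n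
    linarith [key n hn, hγμ n _ hn1]
end
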